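/- arXiv:2305.08270 — 2 statements merged into one kernel-verified Lean document; each statement's English description precedes it below -/
import Mathlib

section
/- Let P, S ∈ K^{n×m} and M = ran [P; S] ⊆ K^n × K^n. Then M is a Dirac structure (M = -M*) if and only if S*P = -P*S and rank [P; S] = n. -/
open scoped BigOperators
open Matrix

noncomputable section

variable {𝕜 : Type*} [RCLike 𝕜]

/-- The pairing ⟨x,y⟩ = y*x = ∑ conj(y i) * x i. -/
def herm {ι : Type*} [Fintype ι] (x y : ι → 𝕜) : 𝕜 :=
  ∑ i, (starRingEnd 𝕜) (y i) * x i

/-- The adjoint relation A* = {(e',f') : ⟨f',e⟩ = ⟨e',f⟩ for all (e,f) ∈ A}. -/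
def adjRel {ι : Type*} [Fintype ι] (A : Submodule 𝕜 ((ι → 𝕜) × (ι → 𝕜))) :
    Submodule 𝕜 ((ι → 𝕜) × (ι → 𝕜)) where
  carrier := {p | ∀ q ∈ A, herm p.2 q.1 = herm p.1 q.2}
  add_mem' := by
    intro a b ha hb q hq
    have h1 := ha q hq
    have h2 := hb q hq
    simp only [herm, Prod.snd_add, Prod.fst_add, Pi.add_apply, mul_add,
      Finset.sum_add_distrib] at *
    rw [h1, h2]
  zero_mem' := by
    intro q hq
    simp [herm]
  smul_mem' := by
    intro c p hp q hq
    have h := hp q hq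
    simp only [herm, Prod.smul_snd, Prod.smul_fst, Pi.smul_apply, smul_eq_mul] at *
    calc ∑ i, (starRingEnd 𝕜) (q.1 i) * (c * p.2 i)
        = c * ∑ i, (starRingEnd 𝕜) (q.1 i) * p.2 i := by
          rw [Finset.mul_sum]; congr 1; ext i; ring
      _ = c * ∑ i, (starRingEnd 𝕜) (q.2 i) * p.1 i := by rw [h]
      _ = ∑ i, (starRingEnd 𝕜) (q.2 i) * (c * p.1 i) := by
          rw [Finset.mul_sum]; congr 1; ext i; ring

/-- The relation −A* = {(e',−f') : (e',f') ∈ A*}. -/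
def negAdj {ι : Type*} [Fintype ι] (A : Submodule 𝕜 ((ι → 𝕜) × (ι → 𝕜))) :
    Submodule 𝕜 ((ι → 𝕜) × (ι → 𝕜)) :=
  (adjRel A).map ((LinearMap.fst 𝕜 (ι → 𝕜) (ι → 𝕜)).prod (-(LinearMap.snd 𝕜 (ι → 𝕜) (ι → 𝕜))))

/-- Kernel representation ker [K, L] = {(f,e) : Kf + Le = 0}. -/
def kerRep {p n : ℕ} (K L : Matrix (Fin p) (Fin n) 𝕜) :
    Submodule 𝕜 ((Fin n → 𝕜) × (Fin n → 𝕜)) :=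
  LinearMap.ker (K.mulVecLin.comp (LinearMap.fst 𝕜 (Fin n → 𝕜) (Fin n → 𝕜)) +
    L.mulVecLin.comp (LinearMap.snd 𝕜 (Fin n → 𝕜) (Fin n → 𝕜)))

/-- Image representation ran [F; G] = {(Fx, Gx) : x}. -/
def ranRep {n m : ℕ} (F G : Matrix (Fin n) (Fin m) 𝕜) :
    Submodule 𝕜 ((Fin n → 𝕜) × (Fin n → 𝕜)) :=
  LinearMap.range (F.mulVecLin.prod G.mulVecLin)

/-- The kernel of a linear relation: ker A = {f : (f,0) ∈ A}. -/
def kerRel {ι : Type*} [Fintype ι] (A : Submodule 𝕜 ((ι → 𝕜) × (ι → 𝕜))) :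
    Submodule 𝕜 (ι → 𝕜) :=
  A.comap (LinearMap.prod LinearMap.id 0)

end

lemma mem_negAdj_iff {𝕜 : Type*} [RCLike 𝕜] {ι : Type*} [Fintype ι]
    (A : Submodule 𝕜 ((ι → 𝕜) × (ι → 𝕜))) (p : (ι → 𝕜) × (ι → 𝕜)) :
    p ∈ negAdj A ↔ ∀ q ∈ A, star q.1 ⬝ᵥ p.2 + star q.2 ⬝ᵥ p.1 = 0 := by
  have mem_adjRel (r : (ι → 𝕜) × (ι → 𝕜)) :
      r ∈ adjRel A ↔ ∀ q ∈ A, star q.1 ⬝ᵥ r.2 = star q.2 ⬝ᵥ r.1 := Iff.rfl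
  simp only [negAdj, Submodule.mem_map, mem_adjRel]
  constructor
  · rintro ⟨r, hr, rfl⟩ q hq
    simp [hr q hq]
  · intro h
    refine ⟨(p.1, -p.2), fun q hq => ?_, by simp⟩
    rw [dotProduct_neg]
    exact (eq_neg_of_add_eq_zero_right (h q hq)).symm

lemma negAdj_ranRep {𝕜 : Type*} [RCLike 𝕜] {n m : ℕ} (P S : Matrix (Fin n) (Fin m) 𝕜) :
    negAdj (ranRep P S) = kerRep Sᴴ Pᴴ := by
  ext p
  have pairing (x : Fin m → 𝕜) :
      star (P *ᵥ x) ⬝ᵥ p.2 + star (S *ᵥ x) ⬝ᵥ p.1 =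
        star x ⬝ᵥ (Sᴴ *ᵥ p.1 + Pᴴ *ᵥ p.2) := by
    rw [star_mulVec, star_mulVec, ← dotProduct_mulVec, ← dotProduct_mulVec, dotProduct_add,
      add_comm]
  have mem_kerRep : p ∈ kerRep Sᴴ Pᴴ ↔ Sᴴ *ᵥ p.1 + Pᴴ *ᵥ p.2 = 0 := Iff.rfl
  rw [mem_negAdj_iff, mem_kerRep]
  constructor
  · intro h
    refine dotProduct_eq_zero _ fun x => ?_
    have hx := h _ ⟨star x, rfl⟩
    change star (P *ᵥ star x) ⬝ᵥ p.2 + star (S *ᵥ star x) ⬝ᵥ p.1 = 0 at hx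
    rw [pairing, star_star] at hx
    rwa [dotProduct_comm]
  · rintro h _ ⟨x, rfl⟩
    change star (P *ᵥ x) ⬝ᵥ p.2 + star (S *ᵥ x) ⬝ᵥ p.1 = 0
    rw [pairing, h, dotProduct_zero]

lemma finrank_ranRep {𝕜 : Type*} [RCLike 𝕜] {n m : ℕ} (P S : Matrix (Fin n) (Fin m) 𝕜) :
    Module.finrank 𝕜 (ranRep P S) = (fromRows P S).rank := by
  let e := LinearEquiv.sumArrowLequivProdArrow (Fin n) (Fin n) 𝕜 𝕜
  have h : P.mulVecLin.prod S.mulVecLin = e.toLinearMap ∘ₗ (fromRows P S).mulVecLin := by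
    ext x i <;> simp [e]
  rw [ranRep, h, LinearMap.range_comp, Matrix.rank]
  exact LinearEquiv.finrank_map_eq e _

lemma finrank_kerRep_add_rank {𝕜 : Type*} [RCLike 𝕜] {p n : ℕ}
    (K L : Matrix (Fin p) (Fin n) 𝕜) :
    Module.finrank 𝕜 (kerRep K L) + (fromCols L K).rank = n + n := by
  have hcol : (fromCols L K).col = Sum.elim L.col K.col := by
    funext j
    cases j <;> rfl
  have h : (fromCols L K).rank =
      Module.finrank 𝕜 (LinearMap.range (K.mulVecLin.coprod L.mulVecLin)) := by
    rw [Matrix.rank, LinearMap.range_coprod, range_mulVecLin, range_mulVecLin, range_mulVecLin,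
      ← Submodule.span_union, Set.union_comm, ← Set.Sum.elim_range, hcol]
  have hdim := (K.mulVecLin.coprod L.mulVecLin).finrank_range_add_finrank_ker
  rw [Module.finrank_prod, Module.finrank_fin_fun, ← h, add_comm] at hdim
  exact hdim

open scoped ComplexOrder in
lemma finrank_negAdj_ranRep_add {𝕜 : Type*} [RCLike 𝕜] {n m : ℕ}
    (P S : Matrix (Fin n) (Fin m) 𝕜) :
    Module.finrank 𝕜 (negAdj (ranRep P S)) + Module.finrank 𝕜 (ranRep P S) = n + n := by
  rw [negAdj_ranRep, finrank_ranRep, ← rank_conjTranspose (fromRows P S),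
    conjTranspose_fromRows_eq_fromCols_conjTranspose]
  exact finrank_kerRep_add_rank _ _

lemma ranRep_le_negAdj_iff {𝕜 : Type*} [RCLike 𝕜] {n m : ℕ} (P S : Matrix (Fin n) (Fin m) 𝕜) :
    ranRep P S ≤ negAdj (ranRep P S) ↔ Sᴴ * P = -(Pᴴ * S) := by
  rw [negAdj_ranRep, ← add_eq_zero_iff_eq_neg, ext_iff_mulVec]
  simp only [add_mulVec, ← mulVec_mulVec, zero_mulVec]
  exact LinearMap.range_le_iff_comap.trans Submodule.eq_top_iff'

/-- ran [P; S] is a Dirac structure iff S*P = -P*S and rank [P;S] = n. -/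
theorem ranRep_dirac_iff {𝕜 : Type*} [RCLike 𝕜] {n m : ℕ}
    (P S : Matrix (Fin n) (Fin m) 𝕜) :
    ranRep P S = negAdj (ranRep P S) ↔
      (Sᴴ * P = -(Pᴴ * S) ∧ Module.finrank 𝕜 (ranRep P S) = n) := by
  have hdim := finrank_negAdj_ranRep_add P S
  rw [← ranRep_le_negAdj_iff]
  constructor
  · intro h
    rw [← h] at hdim
    exact ⟨h.le, by omega⟩
  · rintro ⟨hle, hn⟩
    exact Submodule.eq_of_le_of_finrank_eq hle (by omega)
end

section
/- Let D ⊆ K^N × K^N be a Dirac structure (D = -D*) with l = dim ker D, where ker D = {f : (f,0) ∈ D}. Then there exist an injective matrix G ∈ K^{N×l} and a skew-adjoint matrix M = -M* ∈ K^{N×N} with M(ker G*) ⊆ ker G* such that D = {(Me - Gλ, e) : G*e = 0, λ ∈ K^l}. -/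
open scoped BigOperators
open Matrix

section Herm

variable {𝕜 ι : Type*} [RCLike 𝕜] [Fintype ι]

theorem herm_eq_dotProduct (x y : ι → 𝕜) : herm x y = star y ⬝ᵥ x := rfl

theorem herm_eq_inner (x y : ι → 𝕜) :
    herm x y = inner 𝕜 (WithLp.toLp 2 y) (WithLp.toLp 2 x) := by
  rw [herm_eq_dotProduct, EuclideanSpace.inner_toLp_toLp, dotProduct_comm]

theorem herm_sub_left (x x' y : ι → 𝕜) : herm (x - x') y = herm x y - herm x' y := by
  simp only [herm_eq_dotProduct, dotProduct_sub]

theorem herm_neg_left (x y : ι → 𝕜) : herm (-x) y = -herm x y := by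
  simp only [herm_eq_dotProduct, dotProduct_neg]

theorem herm_zero_left (y : ι → 𝕜) : herm 0 y = 0 := by
  simp only [herm_eq_dotProduct, dotProduct_zero]

theorem herm_zero_right (x : ι → 𝕜) : herm x 0 = 0 := by
  simp only [herm_eq_dotProduct, star_zero, zero_dotProduct]

theorem star_herm (x y : ι → 𝕜) : star (herm x y) = herm y x := by
  rw [herm_eq_dotProduct, herm_eq_dotProduct, star_dotProduct, star_star, dotProduct_comm]

theorem herm_eq_zero_symm {x y : ι → 𝕜} (h : herm x y = 0) : herm y x = 0 := by
  rw [← star_herm, h, star_zero]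

theorem herm_self_eq_zero {x : ι → 𝕜} (h : herm x x = 0) : x = 0 := by
  rw [herm_eq_inner, inner_self_eq_zero] at h
  simpa using h

theorem herm_mulVec_right {κ : Type*} [Fintype κ] (A : Matrix ι κ 𝕜) (x : ι → 𝕜) (y : κ → 𝕜) :
    herm x (A *ᵥ y) = herm (Aᴴ *ᵥ x) y := by
  rw [herm_eq_dotProduct, herm_eq_dotProduct, star_mulVec, dotProduct_mulVec]

theorem conjTranspose_eq_of_herm [DecidableEq ι] {A B : Matrix ι ι 𝕜}
    (h : ∀ x y, herm (B *ᵥ x) y = herm x (A *ᵥ y)) : Aᴴ = B := by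
  refine Matrix.ext_of_mulVec_single fun i => ?_
  refine sub_eq_zero.mp (herm_self_eq_zero ?_)
  rw [herm_sub_left, h, ← herm_mulVec_right, sub_self]

/-- Orthogonal projection along a subspace of `ι → 𝕜`. -/
theorem exists_projection_along (K : Submodule 𝕜 (ι → 𝕜)) :
    ∃ P : (ι → 𝕜) →ₗ[𝕜] (ι → 𝕜), (∀ x, x - P x ∈ K) ∧ ∀ x, ∀ f ∈ K, herm (P x) f = 0 := by
  let L := WithLp.linearEquiv 2 𝕜 (ι → 𝕜)
  let K' : Submodule 𝕜 (EuclideanSpace 𝕜 ι) := K.comap L.toLinearMap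
  refine ⟨L.toLinearMap ∘ₗ K'ᗮ.starProjection.toLinearMap ∘ₗ L.symm.toLinearMap,
    fun x => ?_, fun x f hf => ?_⟩
  · have h : L.symm x - K'ᗮ.starProjection (L.symm x) ∈ K'ᗮᗮ :=
      K'ᗮ.sub_starProjection_mem_orthogonal _
    rw [Submodule.orthogonal_orthogonal] at h
    exact h
  · have h : K'ᗮ.starProjection (L.symm x) ∈ K'ᗮ := K'ᗮ.starProjection_apply_mem _
    rw [herm_eq_inner]
    exact (Submodule.mem_orthogonal _ _).mp h (WithLp.toLp 2 f) hf

theorem mem_of_forall_herm_eq_zero {R : Submodule 𝕜 (ι → 𝕜)} {e : ι → 𝕜}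
    (h : ∀ f, (∀ r ∈ R, herm r f = 0) → herm e f = 0) : e ∈ R := by
  obtain ⟨P, hPR, hP⟩ := exists_projection_along R
  have h0 : ∀ r ∈ R, herm r (P e) = 0 := fun r hr => herm_eq_zero_symm (hP e r hr)
  have h1 := h0 _ (hPR e)
  rw [herm_sub_left, h _ h0, zero_sub, neg_eq_zero] at h1
  simpa [herm_self_eq_zero h1] using hPR e

theorem mem_negAdj {A : Submodule 𝕜 ((ι → 𝕜) × (ι → 𝕜))} {p : (ι → 𝕜) × (ι → 𝕜)} :
    p ∈ negAdj A ↔ ∀ q ∈ A, herm p.2 q.1 + herm p.1 q.2 = 0 := by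
  constructor
  · rintro ⟨r, hr, rfl⟩ q hq
    have h : herm r.2 q.1 = herm r.1 q.2 := hr q hq
    simp [herm_neg_left, h]
  · intro h
    refine ⟨(p.1, -p.2), fun q hq => ?_, by simp⟩
    simpa [herm_neg_left, neg_eq_iff_add_eq_zero] using h q hq

theorem mem_kerRel {A : Submodule 𝕜 ((ι → 𝕜) × (ι → 𝕜))} {f : ι → 𝕜} :
    f ∈ kerRel A ↔ (f, 0) ∈ A := Iff.rfl

section Dirac

variable {D : Submodule 𝕜 ((ι → 𝕜) × (ι → 𝕜))}

theorem herm_kerRel_eq_zero (hD : D = negAdj D) {p : (ι → 𝕜) × (ι → 𝕜)} (hp : p ∈ D)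
    {f : ι → 𝕜} (hf : f ∈ kerRel D) : herm p.2 f = 0 := by
  rw [hD] at hp
  simpa [herm_zero_right] using mem_negAdj.mp hp _ (mem_kerRel.mp hf)

/-- The range of a Dirac structure contains the orthogonal complement of its kernel. -/
theorem mem_range_of_herm_kerRel (hD : D = negAdj D) {e : ι → 𝕜}
    (he : ∀ f ∈ kerRel D, herm e f = 0) : e ∈ D.map (LinearMap.snd 𝕜 (ι → 𝕜) (ι → 𝕜)) := by
  refine mem_of_forall_herm_eq_zero fun f hf => he f ?_
  rw [mem_kerRel, hD, mem_negAdj]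
  intro q hq
  simpa [herm_zero_left] using herm_eq_zero_symm (hf q.2 ⟨q, hq, rfl⟩)

theorem exists_linearMap_of_dirac (hD : D = negAdj D) :
    ∃ m : (ι → 𝕜) →ₗ[𝕜] (ι → 𝕜), (∀ x y, herm (m x) y = -herm x (m y)) ∧
      (∀ x, ∀ f ∈ kerRel D, herm (m x) f = 0) ∧
      ∀ e, (∀ f ∈ kerRel D, herm e f = 0) → (m e, e) ∈ D := by
  obtain ⟨P, hPK, hP⟩ := exists_projection_along (kerRel D)
  let g : D →ₗ[𝕜] D.map (LinearMap.snd 𝕜 (ι → 𝕜) (ι → 𝕜)) :=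
    (LinearMap.snd 𝕜 (ι → 𝕜) (ι → 𝕜)).submoduleMap D
  obtain ⟨s, hs⟩ := g.exists_rightInverse_of_surjective
    (LinearMap.range_eq_top.mpr (LinearMap.submoduleMap_surjective _ _))
  let P' := P.codRestrict (D.map (LinearMap.snd 𝕜 (ι → 𝕜) (ι → 𝕜)))
    fun x => mem_range_of_herm_kerRel hD (hP x)
  let m := P ∘ₗ LinearMap.fst 𝕜 (ι → 𝕜) (ι → 𝕜) ∘ₗ D.subtype ∘ₗ s ∘ₗ P'
  have hm : ∀ x, (m x, P x) ∈ D := fun x => by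
    have h2 : (s (P' x)).1.2 = P x := congrArg Subtype.val (LinearMap.congr_fun hs (P' x))
    have h := D.sub_mem (s (P' x)).2 (mem_kerRel.mp (hPK (s (P' x)).1.1))
    have h3 : (s (P' x)).1 - ((s (P' x)).1.1 - P (s (P' x)).1.1, 0) = (m x, P x) := by
      ext1
      · simp [m]
      · simp [h2]
    rwa [h3] at h
  have hmK : ∀ x, ∀ f ∈ kerRel D, herm (m x) f = 0 := fun x => hP _
  have hproj : ∀ x y, herm (P x) (m y) = herm x (m y) := fun x y => by
    have h := herm_eq_zero_symm (hmK y _ (hPK x))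
    rw [herm_sub_left, sub_eq_zero] at h
    exact h.symm
  refine ⟨m, fun x y => ?_, hmK, fun e he => ?_⟩
  · have h := hm x
    rw [hD] at h
    have h1 := mem_negAdj.mp h _ (hm y)
    have h2 : herm (m x) (P y) = herm (m x) y := by
      rw [← star_herm, hproj, star_herm]
    rw [hproj, h2] at h1
    exact eq_neg_of_add_eq_zero_right h1
  · have h : e - P e = 0 := herm_self_eq_zero <| by
      rw [herm_sub_left, he _ (hPK e), hP e _ (hPK e), sub_zero]
    have h' := hm e
    rwa [← sub_eq_zero.mp h] at h'

end Dirac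

end Herm

/-- representation of a Dirac structure D = {(Me - Gλ, e) : G*e = 0}. -/
theorem dirac_representation {𝕜 : Type*} [RCLike 𝕜] {N : ℕ}
    (D : Submodule 𝕜 ((Fin N → 𝕜) × (Fin N → 𝕜)))
    (hD : D = negAdj D) :
    ∃ (G : Matrix (Fin N) (Fin (Module.finrank 𝕜 (kerRel D))) 𝕜)
      (M : Matrix (Fin N) (Fin N) 𝕜),
      (∀ v, G.mulVec v = 0 → v = 0) ∧
      Mᴴ = -M ∧
      (∀ e : Fin N → 𝕜, Gᴴ.mulVec e = 0 → Gᴴ.mulVec (M.mulVec e) = 0) ∧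
      (∀ p : (Fin N → 𝕜) × (Fin N → 𝕜), p ∈ D ↔
        ∃ lam : Fin (Module.finrank 𝕜 (kerRel D)) → 𝕜,
          Gᴴ.mulVec p.2 = 0 ∧ p.1 = M.mulVec p.2 - G.mulVec lam) := by
  obtain ⟨m, hskew, hmK, hmD⟩ := exists_linearMap_of_dirac hD
  let b := Module.finBasis 𝕜 (kerRel D)
  let γ := (kerRel D).subtype ∘ₗ b.equivFun.symm.toLinearMap
  have hG : ∀ v, LinearMap.toMatrix' γ *ᵥ v = γ v := fun v => by
    rw [← Matrix.toLin'_apply, Matrix.toLin'_toMatrix']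
  have hM : ∀ v, LinearMap.toMatrix' m *ᵥ v = m v := fun v => by
    rw [← Matrix.toLin'_apply, Matrix.toLin'_toMatrix']
  have hγ : ∀ v, γ v ∈ kerRel D := fun v => (b.equivFun.symm v).2
  have hγ_surj : ∀ f ∈ kerRel D, ∃ v, γ v = f := fun f hf =>
    ⟨b.equivFun ⟨f, hf⟩, by simp only [γ, LinearMap.comp_apply, LinearEquiv.coe_coe,
      LinearEquiv.symm_apply_apply, Submodule.subtype_apply]⟩
  have hperp : ∀ e, (LinearMap.toMatrix' γ)ᴴ *ᵥ e = 0 ↔ ∀ f ∈ kerRel D, herm e f = 0 := by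
    refine fun e => ⟨fun h f hf => ?_, fun h => herm_self_eq_zero ?_⟩
    · obtain ⟨v, rfl⟩ := hγ_surj f hf
      rw [← hG, herm_mulVec_right, h, herm_zero_left]
    · rw [← herm_mulVec_right, hG]
      exact h _ (hγ _)
  refine ⟨LinearMap.toMatrix' γ, LinearMap.toMatrix' m, fun v hv => ?_, ?_, fun e _ => ?_,
    fun p => ⟨fun hp => ?_, ?_⟩⟩
  · rw [hG] at hv
    exact b.equivFun.symm.map_eq_zero_iff.mp (Subtype.ext hv)
  · refine conjTranspose_eq_of_herm fun x y => ?_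
    rw [neg_mulVec, hM, hM, herm_neg_left, hskew, neg_neg]
  · rw [hM, hperp]
    exact hmK e
  · have hp2 : ∀ f ∈ kerRel D, herm p.2 f = 0 := fun f hf => herm_kerRel_eq_zero hD hp hf
    have hf : m p.2 - p.1 ∈ kerRel D := by
      have h := D.sub_mem (hmD _ hp2) hp
      rwa [← Prod.mk.eta (p := p), Prod.mk_sub_mk, sub_self] at h
    obtain ⟨v, hv⟩ := hγ_surj _ hf
    exact ⟨v, (hperp _).mpr hp2, by rw [hM, hG, hv, sub_sub_cancel]⟩
  · rintro ⟨v, hp2, hp1⟩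
    have h := D.sub_mem (hmD _ ((hperp _).mp hp2)) (mem_kerRel.mp (hγ v))
    rwa [Prod.mk_sub_mk, sub_zero, ← hG, ← hM, ← hp1] at h
end
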